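/- arXiv:2405.04720 — 8 statements merged into one kernel-verified Lean document; each statement's English description precedes it below -/
import Mathlib

section
/- The functions φ₁ and φ₂ are twice continuously differentiable on (0,∞); in particular, for each of φ₁ and φ₂ the logarithmic branch and the shock branch match to second order at α = 1, so each defines a single C² function on (0,∞). -/
/-- The 1-elementary wave curve of the isothermal hypersonic small-disturbance system:
`φ₁(α) = −(1/a)·ln α` for `0 < α ≤ 1` and `φ₁(α) = −(√2/a)·√((α−1)·ln α/(α+1))` for `α ≥ 1`. -/
noncomputable def phi1 (a α : ℝ) : ℝ :=
  if α ≤ 1 then -(1 / a) * Real.log α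
  else -(Real.sqrt 2 / a) * Real.sqrt ((α - 1) * Real.log α / (α + 1))

/-- The 2-elementary wave curve: `φ₂(α) = −(√2/a)·√(−(1−α)·ln α/(1+α))` for `0 < α ≤ 1`
and `φ₂(α) = (1/a)·ln α` for `α ≥ 1`. -/
noncomputable def phi2 (a α : ℝ) : ℝ :=
  if α ≤ 1 then -(Real.sqrt 2 / a) * Real.sqrt (-((1 - α) * Real.log α) / (1 + α))
  else (1 / a) * Real.log α

/-- Two functions that are `C^n` on an open set and whose derivatives up to order `n` agree at `c`
glue to a `C^n` function. -/
theorem contDiffOn_ite_le {U : Set ℝ} (hU : IsOpen U) {c : ℝ} (hc : c ∈ U) (n : ℕ) {f g : ℝ → ℝ}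
    (hf : ContDiffOn ℝ n f U) (hg : ContDiffOn ℝ n g U)
    (h : ∀ i ≤ n, iteratedDeriv i f c = iteratedDeriv i g c) :
    ContDiffOn ℝ n (fun x => if x ≤ c then f x else g x) U := by
  induction n generalizing f g with
  | zero =>
    have h0 : f c = g c := by simpa using h 0 le_rfl
    rw [Nat.cast_zero, contDiffOn_zero] at *
    intro x hx
    have hfx := hf.continuousAt (hU.mem_nhds hx)
    have hgx := hg.continuousAt (hU.mem_nhds hx)
    refine ContinuousAt.continuousWithinAt ?_
    rcases lt_trichotomy x c with hlt | rfl | hgt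
    · refine hfx.congr ?_
      filter_upwards [eventually_lt_nhds hlt] with y hy
      simp [hy.le]
    · rw [continuousAt_iff_continuous_left_right]
      constructor
      · refine hfx.continuousWithinAt.congr (fun y hy => ?_) (by simp)
        simp only [Set.mem_Iic] at hy
        simp [hy]
      · refine hgx.continuousWithinAt.congr (fun y hy => ?_) (by simp [h0])
        rcases eq_or_lt_of_le (Set.mem_Ici.1 hy) with rfl | hy
        · simp [h0]
        · simp [hy]
    · refine hgx.congr ?_
      filter_upwards [eventually_gt_nhds hgt] with y hy
      simp [hy]
  | succ n ih =>
    have h0 : f c = g c := by simpa using h 0 (Nat.zero_le _)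
    have h1 : deriv f c = deriv g c := by simpa using h 1 (by omega)
    rw [Nat.cast_succ, contDiffOn_succ_iff_deriv_of_isOpen hU] at hf hg ⊢
    obtain ⟨hfd, -, hf'⟩ := hf
    obtain ⟨hgd, -, hg'⟩ := hg
    have key : ∀ x ∈ U, HasDerivAt (fun x => if x ≤ c then f x else g x)
        (if x ≤ c then deriv f x else deriv g x) x := by
      intro x hx
      have hfx := (hfd.differentiableAt (hU.mem_nhds hx)).hasDerivAt
      have hgx := (hgd.differentiableAt (hU.mem_nhds hx)).hasDerivAt
      rcases lt_trichotomy x c with hlt | rfl | hgt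
      · rw [if_pos hlt.le]
        refine hfx.congr_of_eventuallyEq ?_
        filter_upwards [eventually_lt_nhds hlt] with y hy
        simp [hy.le]
      · rw [if_pos le_rfl, ← hasDerivWithinAt_univ, ← Set.Iic_union_Ici (a := x)]
        refine HasDerivWithinAt.union ?_ ?_
        · refine hfx.hasDerivWithinAt.congr (fun y hy => ?_) (by simp)
          simp only [Set.mem_Iic] at hy
          simp [hy]
        · rw [h1]
          refine hgx.hasDerivWithinAt.congr (fun y hy => ?_) (by simp [h0])
          rcases eq_or_lt_of_le (Set.mem_Ici.1 hy) with rfl | hy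
          · simp [h0]
          · simp [hy]
      · rw [if_neg hgt.not_ge]
        refine hgx.congr_of_eventuallyEq ?_
        filter_upwards [eventually_gt_nhds hgt] with y hy
        simp [hy]
    refine ⟨fun x hx => (key x hx).differentiableAt.differentiableWithinAt, by simp, ?_⟩
    refine (ih hf' hg' fun i hi => ?_).congr fun x hx => (key x hx).deriv
    simpa only [iteratedDeriv_succ'] using h (i + 1) (by omega)

theorem iteratedDeriv_sub_mul_self {k : ℝ → ℝ} {c : ℝ} (hk : AnalyticAt ℝ k c) :
    iteratedDeriv 1 (fun x => (x - c) * k x) c = k c ∧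
      iteratedDeriv 2 (fun x => (x - c) * k x) c = 2 * deriv k c := by
  have h : ∀ᶠ x in nhds c, HasDerivAt (fun x => (x - c) * k x) (k x + (x - c) * deriv k x) x := by
    filter_upwards [hk.eventually_analyticAt] with x hx
    refine (((hasDerivAt_id x).sub_const c).mul hx.differentiableAt.hasDerivAt).congr_deriv ?_
    simp
  constructor
  · simpa using h.self_of_nhds.deriv
  · rw [iteratedDeriv_succ, iteratedDeriv_one,
      Filter.EventuallyEq.deriv_eq (h.mono fun x hx => hx.deriv)]
    have h2 := hk.differentiableAt.hasDerivAt.add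
      (((hasDerivAt_id c).sub_const c).mul hk.deriv.differentiableAt.hasDerivAt)
    refine h2.deriv.trans ?_
    simp
    ring

theorem analyticAt_dslope_log {x : ℝ} (hx : 0 < x) : AnalyticAt ℝ (dslope Real.log 1) x := by
  rcases eq_or_ne x 1 with rfl | h
  · obtain ⟨p, hp⟩ := analyticAt_log hx
    exact ⟨_, hp.has_fpower_series_dslope_fslope⟩
  · refine AnalyticAt.congr (f := fun y => (y - 1)⁻¹ * Real.log y) ?_ ?_
    · exact ((analyticAt_id.sub analyticAt_const).inv (sub_ne_zero.2 h)).mul (analyticAt_log hx)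
    · filter_upwards [eventually_ne_nhds h] with y hy
      simp [dslope_of_ne _ hy, slope]

theorem dslope_log_pos {x : ℝ} (hx : 0 < x) : 0 < dslope Real.log 1 x := by
  rcases lt_trichotomy x 1 with h | rfl | h
  · rw [dslope_of_ne _ h.ne, slope_def_field, Real.log_one, sub_zero]
    exact div_pos_of_neg_of_neg (Real.log_neg hx h) (by linarith)
  · simp
  · rw [dslope_of_ne _ h.ne', slope_def_field, Real.log_one, sub_zero]
    exact div_pos (Real.log_pos h) (by linarith)

theorem sub_one_mul_dslope_log (x : ℝ) : (x - 1) * dslope Real.log 1 x = Real.log x := by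
  simpa using sub_smul_dslope Real.log 1 x

/-- The quotient of the shock branch by `α - 1`, extended analytically through `α = 1`. -/
noncomputable def shockSlope (x : ℝ) : ℝ := Real.sqrt (2 * dslope Real.log 1 x / (x + 1))

theorem analyticAt_shockSlope {x : ℝ} (hx : 0 < x) : AnalyticAt ℝ shockSlope x := by
  have hk := dslope_log_pos hx
  have hq : AnalyticAt ℝ (fun x => 2 * dslope Real.log 1 x / (x + 1)) x :=
    (analyticAt_const.mul (analyticAt_dslope_log hx)).div (analyticAt_id.add analyticAt_const)
      (by simp; positivity)
  exact (hq.contDiffAt.sqrt (by positivity)).analyticAt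

theorem shockSlope_one : shockSlope 1 = 1 := by
  norm_num [shockSlope]

theorem deriv_dslope_log_one : deriv (dslope Real.log 1) 1 = -(1 / 2) := by
  have h := (iteratedDeriv_sub_mul_self (analyticAt_dslope_log one_pos)).2
  simp only [sub_one_mul_dslope_log, iteratedDeriv_succ, iteratedDeriv_zero, Real.deriv_log',
    deriv_inv] at h
  norm_num at h
  linarith

theorem deriv_shockSlope_one : deriv shockSlope 1 = -(1 / 2) := by
  have hk := (analyticAt_dslope_log one_pos).differentiableAt.hasDerivAt
  rw [deriv_dslope_log_one] at hk
  have h := ((hk.const_mul 2).div ((hasDerivAt_id (1 : ℝ)).add_const 1) (by norm_num)).sqrt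
    (by norm_num)
  refine h.deriv.trans ?_
  norm_num

theorem iteratedDeriv_shock_eq_log (i : ℕ) (hi : i ≤ 2) :
    iteratedDeriv i (fun x => (x - 1) * shockSlope x) 1 = iteratedDeriv i Real.log 1 := by
  have hS := iteratedDeriv_sub_mul_self (analyticAt_shockSlope one_pos)
  have hL := iteratedDeriv_sub_mul_self (analyticAt_dslope_log one_pos)
  simp only [sub_one_mul_dslope_log] at hL
  interval_cases i
  · simp
  · rw [hS.1, hL.1, shockSlope_one]
    simp
  · rw [hS.2, hL.2, deriv_shockSlope_one, deriv_dslope_log_one]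

theorem sqrt_two_mul_sqrt_eq (x : ℝ) :
    Real.sqrt 2 * Real.sqrt ((x - 1) * Real.log x / (x + 1)) = |x - 1| * shockSlope x := by
  rw [shockSlope, ← Real.sqrt_sq_eq_abs, ← Real.sqrt_mul (by norm_num),
    ← Real.sqrt_mul (sq_nonneg _), ← sub_one_mul_dslope_log]
  congr 1
  ring

/-- The functions `φ₁` and `φ₂` are twice continuously differentiable on `(0,∞)`. -/
theorem phi1_phi2_contDiffOn (a : ℝ) (ha : 0 < a) :
    ContDiffOn ℝ 2 (phi1 a) (Set.Ioi (0 : ℝ)) ∧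
    ContDiffOn ℝ 2 (phi2 a) (Set.Ioi (0 : ℝ)) := by
  have hS : ContDiffOn ℝ (2 : ℕ) (fun x => (x - 1) * shockSlope x) (Set.Ioi 0) := fun x hx =>
    ((analyticAt_id.sub analyticAt_const).mul
      (analyticAt_shockSlope hx)).contDiffAt.contDiffWithinAt
  have hL : ContDiffOn ℝ (2 : ℕ) Real.log (Set.Ioi 0) := fun x hx =>
    (analyticAt_log hx).contDiffAt.contDiffWithinAt
  have h1 : (1 : ℝ) ∈ Set.Ioi (0 : ℝ) := Set.mem_Ioi.2 one_pos
  constructor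
  · refine ((contDiffOn_const (c := -(1 / a))).mul (contDiffOn_ite_le isOpen_Ioi h1 2 hL hS
      fun i hi => (iteratedDeriv_shock_eq_log i hi).symm)).congr fun x _ => ?_
    have hs := sqrt_two_mul_sqrt_eq x
    simp only [phi1]
    split_ifs with h
    · rfl
    · rw [abs_of_pos (by linarith)] at hs
      rw [← hs]
      ring
  · refine ((contDiffOn_const (c := 1 / a)).mul (contDiffOn_ite_le isOpen_Ioi h1 2 hS hL
      iteratedDeriv_shock_eq_log)).congr fun x _ => ?_
    have hs := sqrt_two_mul_sqrt_eq x
    simp only [phi2]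
    split_ifs with h
    · rw [abs_of_nonpos (by linarith)] at hs
      have he : -((1 - x) * Real.log x) / (1 + x) = (x - 1) * Real.log x / (x + 1) := by
        rw [add_comm 1 x]
        ring
      rw [he]
      linear_combination -(1 / a) * hs
    · rfl
end

section
/- For every α > 0 one has φ₁'(α) < 0 and φ₂'(α) > 0; that is, φ₁ is strictly decreasing and φ₂ is strictly increasing on (0,∞). -/
lemma hasDerivAt_phi1_of_lt_one (a : ℝ) {x : ℝ} (hx : 0 < x) (hx1 : x < 1) :
    HasDerivAt (phi1 a) (-(1 / a) * x⁻¹) x := by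
  refine ((Real.hasDerivAt_log hx.ne').const_mul (-(1 / a))).congr_of_eventuallyEq ?_
  filter_upwards [eventually_lt_nhds hx1] with y hy
  simp [phi1, hy.le]

lemma hasDerivAt_phi1_one (a : ℝ) : HasDerivAt (phi1 a) (-(1 / a)) 1 := by
  have left : HasDerivWithinAt (phi1 a) (-(1 / a)) (Set.Iic 1) 1 := by
    have h := ((Real.hasDerivAt_log one_ne_zero).const_mul (-(1 / a))).hasDerivWithinAt
      (s := Set.Iic 1)
    rw [inv_one, mul_one] at h
    exact h.congr (fun y (hy : y ≤ 1) => by simp [phi1, hy]) (by simp [phi1])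
  have right : HasDerivWithinAt (phi1 a) (-(1 / a)) (Set.Ioi 1) 1 := by
    rw [hasDerivWithinAt_iff_tendsto_slope' (by simp)]
    have hlog : Filter.Tendsto (slope Real.log 1) (nhdsWithin 1 (Set.Ioi 1)) (nhds 1) := by
      have h := (Real.hasDerivAt_log one_ne_zero).hasDerivWithinAt (s := Set.Ioi 1)
      rwa [hasDerivWithinAt_iff_tendsto_slope' (by simp), inv_one] at h
    have hadd : Filter.Tendsto (fun y : ℝ => y + 1) (nhdsWithin 1 (Set.Ioi 1))
        (nhds (1 + 1)) :=
      ((continuous_id.add continuous_const).tendsto 1).mono_left nhdsWithin_le_nhds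
    have h := (hlog.div hadd (by norm_num)).sqrt.const_mul (-(Real.sqrt 2 / a))
    have hval : -(Real.sqrt 2 / a) * Real.sqrt (1 / (1 + 1)) = -(1 / a) := by
      rw [neg_mul, div_mul_eq_mul_div, ← Real.sqrt_mul (by norm_num)]
      norm_num
    rw [hval] at h
    refine h.congr' ?_
    filter_upwards [self_mem_nhdsWithin] with y hy
    have hy : 1 < y := hy
    have hpos : 0 < y - 1 := sub_pos.2 hy
    have hsqrt : Real.sqrt ((y - 1) * Real.log y / (y + 1))
        = (y - 1) * Real.sqrt (slope Real.log 1 y / (y + 1)) := by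
      rw [← Real.sqrt_sq hpos.le, ← Real.sqrt_mul (sq_nonneg _), Real.sqrt_sq hpos.le]
      congr 1
      rw [slope_def_field, Real.log_one, sub_zero]
      field_simp
    rw [slope_def_field (phi1 a)]
    simp only [phi1, not_le.2 hy, if_false, le_refl, if_true, Real.log_one, mul_zero, sub_zero,
      hsqrt, Pi.div_apply]
    field_simp
  have h := left.union right
  rwa [Set.Iic_union_Ioi, hasDerivWithinAt_univ] at h

lemma exists_hasDerivAt_phi1_neg_of_one_lt {a : ℝ} (ha : 0 < a) {x : ℝ} (hx : 1 < x) :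
    ∃ d < 0, HasDerivAt (phi1 a) d x := by
  have hlog : 0 < Real.log x := Real.log_pos hx
  have hx0 : 0 < x := by linarith
  have hsub : 0 < x - 1 := by linarith
  have hg := ((((hasDerivAt_id x).sub_const 1).mul (Real.hasDerivAt_log hx0.ne')).div
    ((hasDerivAt_id x).add_const 1) (by simp only [id]; positivity))
  have hgpos : 0 < (x - 1) * Real.log x / (x + 1) := by positivity
  have h := (hg.sqrt hgpos.ne').const_mul (-(Real.sqrt 2 / a))
  refine ⟨_, ?_, h.congr_of_eventuallyEq ?_⟩
  · rw [neg_mul, neg_lt_zero]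
    refine mul_pos (by positivity) (div_pos (div_pos ?_ ?_) ?_)
    · have key : 0 < 2 * Real.log x + (x - 1) * x⁻¹ * (x + 1) := by positivity
      simp only [id, Pi.mul_apply]
      linarith
    · simp only [id]; positivity
    · exact mul_pos two_pos (Real.sqrt_pos.2 hgpos)
  · filter_upwards [eventually_gt_nhds hx] with y hy
    simp [phi1, not_le.2 hy]

lemma exists_hasDerivAt_phi1_neg {a : ℝ} (ha : 0 < a) {x : ℝ} (hx : 0 < x) :
    ∃ d < 0, HasDerivAt (phi1 a) d x := by
  rcases lt_trichotomy x 1 with h | rfl | h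
  · refine ⟨_, ?_, hasDerivAt_phi1_of_lt_one a hx h⟩
    rw [neg_mul, neg_lt_zero]
    positivity
  · exact ⟨_, neg_lt_zero.2 (by positivity), hasDerivAt_phi1_one a⟩
  · exact exists_hasDerivAt_phi1_neg_of_one_lt ha h

lemma phi2_eq_phi1_inv (a : ℝ) {x : ℝ} (hx : 0 < x) : phi2 a x = phi1 a x⁻¹ := by
  rcases lt_trichotomy x 1 with h | rfl | h
  · have hi : ¬ x⁻¹ ≤ 1 := not_le.2 ((one_lt_inv₀ hx).2 h)
    simp only [phi1, phi2, h.le, hi, if_true, if_false, Real.log_inv]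
    congr 2
    field_simp
  · simp [phi1, phi2]
  · simp [phi1, phi2, not_le.2 h, inv_le_one_of_one_le₀ h.le]

lemma exists_hasDerivAt_phi2_pos {a : ℝ} (ha : 0 < a) {x : ℝ} (hx : 0 < x) :
    ∃ d > 0, HasDerivAt (phi2 a) d x := by
  obtain ⟨d, hd, h⟩ := exists_hasDerivAt_phi1_neg ha (inv_pos.2 hx)
  refine ⟨_, ?_, (h.comp x (hasDerivAt_inv hx.ne')).congr_of_eventuallyEq ?_⟩
  · exact mul_pos_of_neg_of_neg hd (neg_lt_zero.2 (by positivity))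
  · filter_upwards [eventually_gt_nhds hx] with y hy
    exact phi2_eq_phi1_inv a hy

/-- For every `α > 0` one has `φ₁'(α) < 0` and `φ₂'(α) > 0`: `φ₁` is strictly
decreasing and `φ₂` is strictly increasing on `(0,∞)`. -/
theorem phi1_deriv_neg_phi2_deriv_pos (a : ℝ) (ha : 0 < a) :
    (∀ α : ℝ, 0 < α → deriv (phi1 a) α < 0 ∧ 0 < deriv (phi2 a) α) ∧
    StrictAntiOn (phi1 a) (Set.Ioi (0 : ℝ)) ∧ StrictMonoOn (phi2 a) (Set.Ioi (0 : ℝ)) := by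
  have h1 : ∀ x : ℝ, 0 < x → deriv (phi1 a) x < 0 := fun x hx => by
    obtain ⟨d, hd, h⟩ := exists_hasDerivAt_phi1_neg ha hx
    rwa [h.deriv]
  have h2 : ∀ x : ℝ, 0 < x → 0 < deriv (phi2 a) x := fun x hx => by
    obtain ⟨d, hd, h⟩ := exists_hasDerivAt_phi2_pos ha hx
    rwa [h.deriv]
  refine ⟨fun x hx => ⟨h1 x hx, h2 x hx⟩, ?_, ?_⟩
  · refine strictAntiOn_of_deriv_neg (convex_Ioi 0) (fun x hx => ?_) fun x hx => ?_
    · obtain ⟨d, -, h⟩ := exists_hasDerivAt_phi1_neg ha hx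
      exact h.continuousAt.continuousWithinAt
    · rw [interior_Ioi] at hx
      exact h1 x hx
  · refine strictMonoOn_of_deriv_pos (convex_Ioi 0) (fun x hx => ?_) fun x hx => ?_
    · obtain ⟨d, -, h⟩ := exists_hasDerivAt_phi2_pos ha hx
      exact h.continuousAt.continuousWithinAt
    · rw [interior_Ioi] at hx
      exact h2 x hx
end

section
/- The derivative g'(α) tends to −1/a_∞ as α → 1⁺, and g'(α) tends to 0 as α → ∞. -/
/-- The 1-shock branch of the elementary wave curve of the isothermal hypersonic
small-disturbance system: `g(α) = −(√2/a)·√((α−1)·ln α/(α+1))`. -/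
noncomputable def gShock (a α : ℝ) : ℝ :=
  -(Real.sqrt 2 / a) * Real.sqrt ((α - 1) * Real.log α / (α + 1))

open Filter Topology

/-- The derivative of the 1-shock branch on `(1, ∞)`. -/
theorem hasDerivAt_gShock (a : ℝ) {x : ℝ} (hx : 1 < x) :
    HasDerivAt (gShock a)
      (-(Real.sqrt 2 / a) * ((2 * Real.log x / (x + 1) ^ 2 + (x - 1) / (x * (x + 1))) /
        (2 * Real.sqrt ((x - 1) * Real.log x / (x + 1))))) x := by
  have hlog : 0 < Real.log x := Real.log_pos hx
  have hx0 : x ≠ 0 := by positivity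
  have hx1 : x + 1 ≠ 0 := by positivity
  have hf : (x - 1) * Real.log x / (x + 1) ≠ 0 :=
    (div_pos (mul_pos (sub_pos.2 hx) hlog) (by positivity)).ne'
  have h := ((((((hasDerivAt_id x).sub_const 1).mul (Real.hasDerivAt_log hx0)).div
    ((hasDerivAt_id x).add_const 1) hx1).sqrt hf).const_mul (-(Real.sqrt 2 / a)))
  refine h.congr_deriv ?_
  congr 2
  simp only [Pi.mul_apply, id_eq]
  field_simp
  ring

/-- Dividing out `x - 1` gives a form of the derivative which is regular at `1`. -/
theorem deriv_gShock_eq (a : ℝ) {x : ℝ} (hx : 1 < x) :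
    deriv (gShock a) x =
      -(Real.sqrt 2 / a) * ((2 * (Real.log x / (x - 1)) / (x + 1) ^ 2 + 1 / (x * (x + 1))) /
        (2 * Real.sqrt (Real.log x / (x - 1) / (x + 1)))) := by
  have hx1 : 0 < x - 1 := sub_pos.2 hx
  have hlog : 0 < Real.log x := Real.log_pos hx
  have hsqrt : Real.sqrt ((x - 1) * Real.log x / (x + 1)) =
      (x - 1) * Real.sqrt (Real.log x / (x - 1) / (x + 1)) := by
    rw [← Real.sqrt_sq hx1.le, ← Real.sqrt_mul (sq_nonneg _), Real.sqrt_sq hx1.le]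
    congr 1
    field_simp
  have hs : 0 < Real.sqrt (Real.log x / (x - 1) / (x + 1)) :=
    Real.sqrt_pos.2 (by positivity)
  rw [(hasDerivAt_gShock a hx).deriv, hsqrt]
  congr 1
  generalize Real.sqrt (Real.log x / (x - 1) / (x + 1)) = s at hs
  field_simp

theorem tendsto_log_div_sub_one :
    Tendsto (fun x : ℝ => Real.log x / (x - 1)) (𝓝[>] 1) (𝓝 1) := by
  have h := (hasDerivAt_iff_tendsto_slope.1 (Real.hasDerivAt_log one_ne_zero)).mono_left
    (nhdsWithin_mono (1 : ℝ) fun x (hx : x ∈ Set.Ioi (1 : ℝ)) => (ne_of_gt hx : x ≠ 1))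
  simpa [slope_fun_def_field] using h

theorem tendsto_deriv_gShock_one (a : ℝ) :
    Tendsto (deriv (gShock a)) (𝓝[>] 1) (𝓝 (-(1 / a))) := by
  have hid : Tendsto (fun x : ℝ => x) (𝓝[>] 1) (𝓝 1) :=
    tendsto_nhdsWithin_of_tendsto_nhds tendsto_id
  have hq := tendsto_log_div_sub_one
  have hs := ((hq.div (hid.add_const 1) (by norm_num)).sqrt).const_mul 2
  have hn := ((hq.const_mul 2).div ((hid.add_const 1).pow 2) (by norm_num)).add
    ((tendsto_const_nhds (x := (1 : ℝ))).div (hid.mul (hid.add_const 1)) (by norm_num))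
  have h := (hn.div hs (by positivity)).const_mul (-(Real.sqrt 2 / a))
  have hlim : -(Real.sqrt 2 / a) * ((2 * 1 / (1 + 1) ^ 2 + 1 / (1 * (1 + 1))) /
      (2 * Real.sqrt (1 / (1 + 1)))) = -(1 / a) := by
    have h2 : Real.sqrt 2 * Real.sqrt 2 = 2 := Real.mul_self_sqrt zero_le_two
    have h0 : Real.sqrt 2 ≠ 0 := by positivity
    have hc : Real.sqrt 2 * ((2 * 1 / (1 + 1) ^ 2 + 1 / (1 * (1 + 1))) /
        (2 * Real.sqrt (1 / (1 + 1)))) = 1 := by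
      rw [show (1 : ℝ) + 1 = 2 by norm_num, Real.sqrt_div zero_le_one, Real.sqrt_one]
      field_simp
      linear_combination 2 * h2
    linear_combination (-a⁻¹) * hc
  rw [hlim] at h
  refine h.congr' ?_
  filter_upwards [self_mem_nhdsWithin] with x hx
  exact (deriv_gShock_eq a hx).symm

theorem abs_deriv_gShock_le {a : ℝ} (ha : 0 < a) {x : ℝ} (hx : 3 ≤ x) :
    |deriv (gShock a) x| ≤ Real.sqrt 2 / a * (3 / (x + 1)) := by
  have hlog : 1 ≤ Real.log x := by
    rw [Real.le_log_iff_exp_le (by linarith)]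
    linarith [Real.exp_one_lt_d9]
  have hlog_le : Real.log x ≤ x - 1 := Real.log_le_sub_one_of_pos (by linarith)
  have hx1 : 0 ≤ x - 1 := by linarith
  have hs : 1 ≤ 2 * Real.sqrt ((x - 1) * Real.log x / (x + 1)) := by
    have : 1 / 2 ≤ Real.sqrt ((x - 1) * Real.log x / (x + 1)) := by
      apply Real.le_sqrt_of_sq_le
      rw [le_div_iff₀ (by linarith)]
      nlinarith
    linarith
  have hn : 2 * Real.log x / (x + 1) ^ 2 + (x - 1) / (x * (x + 1)) ≤ 3 / (x + 1) := by
    have h1 : 2 * Real.log x / (x + 1) ^ 2 ≤ 2 / (x + 1) := by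
      rw [div_le_div_iff₀ (by positivity) (by positivity)]
      nlinarith [mul_nonneg (by linarith : 0 ≤ x + 1 - Real.log x) (by linarith : 0 ≤ x + 1)]
    have h2 : (x - 1) / (x * (x + 1)) ≤ 1 / (x + 1) := by
      rw [div_le_div_iff₀ (by positivity) (by positivity)]
      nlinarith
    calc _ ≤ 2 / (x + 1) + 1 / (x + 1) := add_le_add h1 h2
      _ = 3 / (x + 1) := by ring
  have hn0 : 0 ≤ 2 * Real.log x / (x + 1) ^ 2 + (x - 1) / (x * (x + 1)) := by positivity
  rw [(hasDerivAt_gShock a (by linarith)).deriv, abs_mul, abs_neg,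
    abs_of_nonneg (by positivity : 0 ≤ Real.sqrt 2 / a),
    abs_of_nonneg (div_nonneg hn0 (by positivity))]
  refine mul_le_mul_of_nonneg_left ?_ (by positivity)
  exact (div_le_self hn0 hs).trans hn

theorem tendsto_deriv_gShock_atTop {a : ℝ} (ha : 0 < a) :
    Tendsto (deriv (gShock a)) atTop (𝓝 0) := by
  have h : Tendsto (fun x : ℝ => Real.sqrt 2 / a * (3 / (x + 1))) atTop (𝓝 0) := by
    simpa using ((tendsto_atTop_add_const_right _ (1 : ℝ) tendsto_id).const_div_atTop
      (3 : ℝ)).const_mul (Real.sqrt 2 / a)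
  refine squeeze_zero_norm' ?_ h
  filter_upwards [eventually_ge_atTop 3] with x hx
  exact abs_deriv_gShock_le ha hx

/-- The derivative `g'(α)` tends to `−1/a_∞` as `α → 1⁺`, and tends to `0` as `α → ∞`. -/
theorem gShock_deriv_limits (a : ℝ) (ha : 0 < a) :
    Filter.Tendsto (deriv (gShock a)) (nhdsWithin 1 (Set.Ioi 1)) (nhds (-(1 / a))) ∧
    Filter.Tendsto (deriv (gShock a)) Filter.atTop (nhds 0) := by
  exact ⟨tendsto_deriv_gShock_one a, tendsto_deriv_gShock_atTop ha⟩
end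

section
/- For all real v_L and b₀ there is a unique α > 0 with φ₁(α) + v_L − b₀ = 0. If v_L ≤ b₀, this unique solution is α = exp(a_∞(v_L − b₀)), which lies in (0,1]; if v_L > b₀, the unique solution lies in (1,∞). (This solves the Riemann problem with boundary for the hypersonic small-disturbance system: the state U_L is connected to the boundary data v = b₀ by a single 1-family wave.) -/
/-- The quantity under the square root on the shock branch is strictly increasing. -/
lemma strictMonoOn_shock :
    StrictMonoOn (fun α : ℝ => (α - 1) * Real.log α / (α + 1)) (Set.Ici 1) := by
  intro x hx y hy hxy
  have hx1 : (1 : ℝ) ≤ x := hx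
  have hlog : Real.log x < Real.log y := Real.log_lt_log (by linarith) hxy
  have hlx : 0 ≤ Real.log x := Real.log_nonneg hx1
  have hfrac : (x - 1) / (x + 1) < (y - 1) / (y + 1) := by
    rw [div_lt_div_iff₀ (by linarith) (by linarith)]
    nlinarith
  have hfx : 0 ≤ (x - 1) / (x + 1) := div_nonneg (by linarith) (by linarith)
  simp only [mul_div_right_comm]
  exact mul_lt_mul'' hfrac hlog hfx hlx

/-- The shock branch attains every positive value. -/
lemma exists_shock_eq {T : ℝ} (hT : 0 < T) :
    ∃ α : ℝ, 1 < α ∧ (α - 1) * Real.log α / (α + 1) = T := by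
  have hM : 2 * T + 2 + 1 ≤ Real.exp (2 * T + 2) := Real.add_one_le_exp _
  have hcont : ContinuousOn (fun α : ℝ => (α - 1) * Real.log α / (α + 1))
      (Set.Icc 1 (Real.exp (2 * T + 2))) := by
    refine ContinuousOn.div (ContinuousOn.mul (by fun_prop) ?_) (by fun_prop) ?_
    · exact Real.continuousOn_log.mono fun x hx => by
        have := hx.1
        simp only [Set.mem_compl_iff, Set.mem_singleton_iff]
        linarith
    · intro x hx
      have := hx.1
      linarith
  have hmem : T ∈ Set.Icc ((fun α : ℝ => (α - 1) * Real.log α / (α + 1)) 1)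
      ((fun α : ℝ => (α - 1) * Real.log α / (α + 1)) (Real.exp (2 * T + 2))) := by
    refine ⟨by simpa using hT.le, ?_⟩
    simp only [Real.log_exp]
    rw [le_div_iff₀ (by linarith)]
    nlinarith
  obtain ⟨α, hα, h⟩ := intermediate_value_Icc (by linarith) hcont hmem
  refine ⟨α, lt_of_le_of_ne hα.1 ?_, h⟩
  rintro rfl
  simp at h
  exact hT.ne h

lemma phi1_nonneg_of_le_one {a α : ℝ} (ha : 0 < a) (h0 : 0 < α) (h1 : α ≤ 1) :
    0 ≤ phi1 a α := by
  rw [phi1, if_pos h1, neg_mul, ← mul_neg]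
  exact mul_nonneg (by positivity) (neg_nonneg.2 (Real.log_nonpos h0.le h1))

lemma phi1_neg_of_one_lt {a α : ℝ} (ha : 0 < a) (h1 : 1 < α) : phi1 a α < 0 := by
  have hl := Real.log_pos h1
  have : 0 < (α - 1) * Real.log α / (α + 1) :=
    div_pos (mul_pos (by linarith) hl) (by linarith)
  rw [phi1, if_neg h1.not_ge, neg_mul, neg_lt_zero]
  positivity

/-- The 1-elementary wave curve is strictly decreasing. -/
lemma strictAntiOn_phi1 {a : ℝ} (ha : 0 < a) : StrictAntiOn (phi1 a) (Set.Ioi 0) := by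
  intro x hx y hy hxy
  have hx0 : (0 : ℝ) < x := hx
  rcases le_or_gt y 1 with hy1 | hy1
  · rw [phi1, phi1, if_pos hy1, if_pos (hxy.le.trans hy1), neg_mul, neg_mul, neg_lt_neg_iff]
    exact mul_lt_mul_of_pos_left (Real.log_lt_log hx0 hxy) (by positivity)
  rcases le_or_gt x 1 with hx1 | hx1
  · exact (phi1_neg_of_one_lt ha hy1).trans_le (phi1_nonneg_of_le_one ha hx0 hx1)
  · rw [phi1, phi1, if_neg hy1.not_ge, if_neg hx1.not_ge, neg_mul, neg_mul, neg_lt_neg_iff]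
    refine mul_lt_mul_of_pos_left (Real.sqrt_lt_sqrt ?_ (strictMonoOn_shock hx1.le hy1.le hxy))
      (by positivity)
    exact div_nonneg (mul_nonneg (by linarith) (Real.log_nonneg hx1.le)) (by linarith)

lemma phi1_exp {a t : ℝ} (ha : 0 < a) (ht : t ≤ 0) : phi1 a (Real.exp (a * t)) = -t := by
  have h : Real.exp (a * t) ≤ 1 := Real.exp_le_one_iff.2 (mul_nonpos_of_nonneg_of_nonpos ha.le ht)
  rw [phi1, if_pos h, Real.log_exp]
  field_simp

lemma exists_phi1_eq_neg {a t : ℝ} (ha : 0 < a) (ht : 0 < t) :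
    ∃ α : ℝ, 1 < α ∧ phi1 a α = -t := by
  obtain ⟨α, h1, h⟩ := exists_shock_eq (T := (a * t) ^ 2 / 2) (by positivity)
  refine ⟨α, h1, ?_⟩
  rw [phi1, if_neg h1.not_ge, h, Real.sqrt_div (by positivity), Real.sqrt_sq (by positivity)]
  field_simp

/-- For all real `v_L` and `b₀` there is a unique `α > 0` with `φ₁(α) + v_L − b₀ = 0`.
If `v_L ≤ b₀`, this unique solution is `α = exp(a(v_L − b₀)) ∈ (0,1]`; if `v_L > b₀`,
the unique solution lies in `(1,∞)`. -/
theorem boundary_riemann_solvability (a : ℝ) (ha : 0 < a) (vL b0 : ℝ) :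
    (∃! α : ℝ, 0 < α ∧ phi1 a α + vL - b0 = 0) ∧
    (vL ≤ b0 → ∀ α : ℝ, 0 < α → phi1 a α + vL - b0 = 0 →
      α = Real.exp (a * (vL - b0)) ∧ α ∈ Set.Ioc (0 : ℝ) 1) ∧
    (b0 < vL → ∀ α : ℝ, 0 < α → phi1 a α + vL - b0 = 0 → 1 < α) := by
  have hinj : ∀ {x y : ℝ}, 0 < x → 0 < y → phi1 a x = phi1 a y → x = y :=
    fun hx hy h => (strictAntiOn_phi1 ha).injOn hx hy h
  refine ⟨?_, fun hle α h0 h => ?_, fun hlt α h0 h => ?_⟩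
  · have hex : ∃ α : ℝ, 0 < α ∧ phi1 a α = -(vL - b0) := by
      rcases le_or_gt vL b0 with hle | hlt
      · exact ⟨_, Real.exp_pos _, phi1_exp ha (sub_nonpos.2 hle)⟩
      · obtain ⟨α, h1, h⟩ := exists_phi1_eq_neg ha (sub_pos.2 hlt)
        exact ⟨α, by linarith, h⟩
    obtain ⟨α, h0, h⟩ := hex
    exact ⟨α, ⟨h0, by linarith⟩, fun β hβ => hinj hβ.1 h0 (by linarith [hβ.2])⟩
  · have hα : α = Real.exp (a * (vL - b0)) :=
      hinj h0 (Real.exp_pos _) (by linarith [phi1_exp ha (sub_nonpos.2 hle)])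
    refine ⟨hα, h0, ?_⟩
    rw [hα, Real.exp_le_one_iff]
    exact mul_nonpos_of_nonneg_of_nonpos ha.le (sub_nonpos.2 hle)
  · by_contra! h1
    linarith [phi1_nonneg_of_le_one ha h0 h1]
end

section
/- For each fixed ρ > 0, v ∈ ℝ and each j ∈ {1,2}, the right-eigenvector r_j(ρ,v,ε,τ) = (−1)^j · (ρ, ρ^ε/(a_∞²(√(1 − τ²B(ρ,v,ε))·λ_j(ρ,v,ε,τ) − v))) converges to ((−1)^j ρ, 1/a_∞) as (ε,τ) → (0,0) with ε > 0. -/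
/-- The Bernoulli-type quantity `B(ρ,v,ε) = 2(ρ^ε − 1)/(a²ε) + v²`. -/
noncomputable def Bfun (a ρ v ε : ℝ) : ℝ := 2 * (ρ ^ ε - 1) / (a ^ 2 * ε) + v ^ 2

/-- The eigenvalues of the scaled two-dimensional steady potential-flow system. -/
noncomputable def lam (a ρ v ε τ : ℝ) (j : ℕ) : ℝ :=
  (a ^ 2 * v * Real.sqrt (1 - τ ^ 2 * Bfun a ρ v ε) +
      (-1 : ℝ) ^ j * ρ ^ (ε / 2) *
        Real.sqrt (a ^ 2 - τ ^ 2 * ε⁻¹ * ((ε + 2) * ρ ^ ε - 2))) /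
    (a ^ 2 * (1 - τ ^ 2 * (Bfun a ρ v ε + ρ ^ ε / a ^ 2)))

/-- The right-eigenvector
`r_j = (−1)^j (ρ, ρ^ε/(a²(√(1 − τ²B)·λ_j − v)))`. -/
noncomputable def rvec (a ρ v ε τ : ℝ) (j : ℕ) : ℝ × ℝ :=
  ((-1 : ℝ) ^ j * ρ,
    (-1 : ℝ) ^ j *
      (ρ ^ ε /
        (a ^ 2 * (Real.sqrt (1 - τ ^ 2 * Bfun a ρ v ε) * lam a ρ v ε τ j - v))))

open Filter Topology in
/-- The difference quotient of `ε ↦ ρ ^ ε` at `0` tends to `log ρ`. -/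
theorem tendsto_rpow_sub_one_div {ρ : ℝ} (hρ : 0 < ρ) :
    Tendsto (fun ε : ℝ => (ρ ^ ε - 1) / ε) (𝓝[>] 0) (𝓝 (Real.log ρ)) := by
  have h : HasDerivAt (fun ε : ℝ => ρ ^ ε) (Real.log ρ) 0 := by
    simpa using Real.hasStrictDerivAt_const_rpow hρ 0 |>.hasDerivAt
  simpa [div_eq_inv_mul] using h.tendsto_slope_zero_right

open Filter Topology in
theorem tendsto_Bfun {a ρ : ℝ} (v : ℝ) (hρ : 0 < ρ) :
    Tendsto (Bfun a ρ v) (𝓝[>] 0) (𝓝 (2 / a ^ 2 * Real.log ρ + v ^ 2)) := by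
  refine (((tendsto_rpow_sub_one_div hρ).const_mul (2 / a ^ 2)).add_const (v ^ 2)).congr fun ε => ?_
  rw [Bfun, div_mul_div_comm]

open Filter Topology in
theorem tendsto_inv_mul_add_two_mul_rpow_sub_two {ρ : ℝ} (hρ : 0 < ρ) :
    Tendsto (fun ε : ℝ => ε⁻¹ * ((ε + 2) * ρ ^ ε - 2)) (𝓝[>] 0)
      (𝓝 (1 + 2 * Real.log ρ)) := by
  have h : Tendsto (fun ε : ℝ => ρ ^ ε) (𝓝[>] 0) (𝓝 1) := by
    simpa using ((Real.continuous_const_rpow hρ.ne').tendsto 0).mono_left nhdsWithin_le_nhds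
  refine (h.add ((tendsto_rpow_sub_one_div hρ).const_mul 2)).congr' ?_
  filter_upwards [self_mem_nhdsWithin] with ε hε
  have : ε ≠ 0 := ne_of_gt hε
  field_simp
  ring

/-- For each fixed `ρ > 0`, `v ∈ ℝ` and `j ∈ {1,2}`, the right-eigenvector
`r_j(ρ,v,ε,τ)` converges to `((−1)^j ρ, 1/a_∞)` as `(ε,τ) → (0,0)` with `ε > 0`. -/
theorem rvec_limit (a ρ v : ℝ) (ha : 0 < a) (hρ : 0 < ρ) :
    ∀ j : ℕ, j = 1 ∨ j = 2 →
      Filter.Tendsto (fun p : ℝ × ℝ => rvec a ρ v p.1 p.2 j)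
        (nhdsWithin (0, 0) {p : ℝ × ℝ | 0 < p.1})
        (nhds ((-1 : ℝ) ^ j * ρ, 1 / a)) := by
  intro j _
  set l := nhdsWithin ((0 : ℝ), (0 : ℝ)) {p : ℝ × ℝ | 0 < p.1}
  have hε : Filter.Tendsto Prod.fst l (nhdsWithin (0 : ℝ) (Set.Ioi 0)) :=
    (continuous_fst.tendsto _).inf (Filter.tendsto_principal_principal.2 fun _ h => h)
  have hε' : Filter.Tendsto Prod.fst l (nhds (0 : ℝ)) := hε.mono_right nhdsWithin_le_nhds
  have hτ : Filter.Tendsto (fun p : ℝ × ℝ => p.2 ^ 2) l (nhds 0) := by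
    simpa using ((continuous_snd.tendsto ((0 : ℝ), (0 : ℝ))).pow 2).mono_left nhdsWithin_le_nhds
  have hpow : Filter.Tendsto (fun p : ℝ × ℝ => ρ ^ p.1) l (nhds 1) := by
    simpa [Function.comp_def] using ((Real.continuous_const_rpow hρ.ne').tendsto 0).comp hε'
  have hpow_half : Filter.Tendsto (fun p : ℝ × ℝ => ρ ^ (p.1 / 2)) l (nhds 1) := by
    simpa [Function.comp_def] using
      ((Real.continuous_const_rpow hρ.ne').tendsto _).comp (hε'.div_const 2)
  have hB := (tendsto_Bfun (a := a) v hρ).comp hε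
  have hsqrt : Filter.Tendsto (fun p : ℝ × ℝ => Real.sqrt (1 - p.2 ^ 2 * Bfun a ρ v p.1)) l
      (nhds 1) := by
    simpa using ((hτ.mul hB).const_sub 1).sqrt
  have hsqrt' : Filter.Tendsto (fun p : ℝ × ℝ =>
      Real.sqrt (a ^ 2 - p.2 ^ 2 * p.1⁻¹ * ((p.1 + 2) * ρ ^ p.1 - 2))) l (nhds a) := by
    have h :=
      ((hτ.mul ((tendsto_inv_mul_add_two_mul_rpow_sub_two hρ).comp hε)).const_sub (a ^ 2)).sqrt
    rw [zero_mul, sub_zero, Real.sqrt_sq ha.le] at h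
    simpa [mul_assoc] using h
  have hden : Filter.Tendsto (fun p : ℝ × ℝ =>
      a ^ 2 * (1 - p.2 ^ 2 * (Bfun a ρ v p.1 + ρ ^ p.1 / a ^ 2))) l (nhds (a ^ 2)) := by
    simpa using ((hτ.mul (hB.add (hpow.div_const (a ^ 2)))).const_sub 1).const_mul (a ^ 2)
  have hlam : Filter.Tendsto (fun p : ℝ × ℝ => lam a ρ v p.1 p.2 j) l
      (nhds (v + (-1) ^ j / a)) := by
    have h := ((hsqrt.const_mul (a ^ 2 * v)).add
      ((hpow_half.const_mul ((-1) ^ j)).mul hsqrt')).div hden (pow_ne_zero 2 ha.ne')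
    have hlim : (a ^ 2 * v * 1 + (-1) ^ j * 1 * a) / a ^ 2 = v + (-1) ^ j / a := by
      field_simp
    rwa [hlim] at h
  refine tendsto_const_nhds.prodMk_nhds ?_
  have h := (hpow.div (((hsqrt.mul hlam).sub_const v).const_mul (a ^ 2)) (by
    have := ha.ne'
    rw [one_mul, add_sub_cancel_left]
    positivity)).const_mul ((-1 : ℝ) ^ j)
  have hlim : (-1 : ℝ) ^ j * (1 / (a ^ 2 * (1 * (v + (-1) ^ j / a) - v))) = 1 / a := by
    rw [one_mul, add_sub_cancel_left]
    field_simp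
  rwa [hlim] at h
end

section
/- There exist positive constants δ₀, ε₀, τ₀ and C, depending only on a_∞ and K, such that whenever 0 < δ < δ₀, 0 < ε < ε₀, 0 < τ < τ₀ and β₁ > 0 satisfies |β₁ − 1 − a_∞δ| ≤ K(δ + ε + τ²)δ, one has |((ε·ln β₁ − 1)·β₁^ε + 1)/ε² − a_∞²δ²/2| ≤ C(δ + ε + τ²)δ². -/
/-- Third-order Taylor bound for `(x - 1) * exp x + 1`. -/
theorem abs_sub_one_mul_exp_add_one_sub_le {x : ℝ} (hx : |x| ≤ 1) :
    |(x - 1) * Real.exp x + 1 - x ^ 2 / 2| ≤ |x| ^ 3 := by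
  have h := Real.exp_bound hx (n := 3) (by norm_num)
  norm_num [Finset.sum_range_succ, Nat.factorial] at h
  have hx1 : |x - 1| ≤ 2 := by
    rw [abs_le] at hx ⊢
    constructor <;> linarith [hx.1, hx.2]
  have e : (x - 1) * Real.exp x + 1 - x ^ 2 / 2 =
      (x - 1) * (Real.exp x - (1 + x + x ^ 2 / 2)) + x ^ 3 / 2 := by ring
  have h3 : |x ^ 3 / 2| = |x| ^ 3 / 2 := by
    rw [abs_div, abs_pow, abs_of_pos (by norm_num : (0 : ℝ) < 2)]
  have hp : 0 ≤ |x| ^ 3 := by positivity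
  calc |(x - 1) * Real.exp x + 1 - x ^ 2 / 2|
      ≤ |x - 1| * |Real.exp x - (1 + x + x ^ 2 / 2)| + |x| ^ 3 / 2 := by
        rw [e, ← h3, ← abs_mul]
        exact abs_add_le _ _
    _ ≤ 2 * (|x| ^ 3 * (2 / 9)) + |x| ^ 3 / 2 := by gcongr
    _ ≤ |x| ^ 3 := by linarith

/-- Second-order Taylor bound for `Real.log` near `1`. -/
theorem abs_log_sub_sub_one_le {b : ℝ} (hb : |b - 1| ≤ 1 / 2) :
    |Real.log b - (b - 1)| ≤ 2 * (b - 1) ^ 2 := by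
  have hb' : 1 / 2 ≤ b := by linarith [(abs_le.mp hb).1]
  have hpos : 0 < b := by linarith
  have h1 := Real.log_le_sub_one_of_pos hpos
  have h2 := Real.one_sub_inv_le_log_of_pos hpos
  have h3 : 1 - b⁻¹ = (b - 1) - (b - 1) ^ 2 * b⁻¹ := by
    field_simp
    ring
  have h4 : b⁻¹ ≤ 2 := inv_le_of_inv_le₀ (by norm_num) (by linarith)
  have h5 : (b - 1) ^ 2 * b⁻¹ ≤ (b - 1) ^ 2 * 2 := by gcongr
  rw [abs_le]
  constructor <;> nlinarith [sq_nonneg (b - 1)]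

/-- If the 1-shock strength satisfies the expansion `β₁ = 1 + a_∞δ + O(δ+ε+τ²)δ`, then
`((ε ln β₁ − 1)β₁^ε + 1)/ε² = a_∞²δ²/2 + O(δ+ε+τ²)δ²`, with constants depending only on
`a_∞` and `K`. -/
theorem shock_second_order_estimate (a K : ℝ) (ha : 0 < a) (hK : 0 < K) :
    ∃ δ₀ ε₀ τ₀ C : ℝ, 0 < δ₀ ∧ 0 < ε₀ ∧ 0 < τ₀ ∧ 0 < C ∧
      ∀ δ ε τ β : ℝ, 0 < δ → δ < δ₀ → 0 < ε → ε < ε₀ → 0 < τ → τ < τ₀ → 0 < β →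
        |β - 1 - a * δ| ≤ K * (δ + ε + τ ^ 2) * δ →
        |((ε * Real.log β - 1) * β ^ ε + 1) / ε ^ 2 - a ^ 2 * δ ^ 2 / 2| ≤
          C * (δ + ε + τ ^ 2) * δ ^ 2 := by
  obtain ⟨M, hM⟩ : ∃ M, M = a + 3 * K := ⟨_, rfl⟩
  have hMpos : 0 < M := by rw [hM]; positivity
  refine ⟨1 / (2 * M + 2), 1, 1, 8 * M ^ 3 + (2 * M ^ 2 + K) * (2 * M + a), by positivity,
    one_pos, one_pos, by positivity, ?_⟩
  intro δ ε τ β hδ hδ₀ hε hε₁ hτ hτ₁ hβ h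
  have hδM : δ * (2 * M + 2) < 1 := (lt_div_iff₀ (by positivity)).mp hδ₀
  have hMδ : 0 < M * δ := by positivity
  have hδ₁ : δ ≤ 1 := by linarith
  obtain ⟨S, hS⟩ : ∃ S, S = δ + ε + τ ^ 2 := ⟨_, rfl⟩
  rw [← hS] at h ⊢
  have hτ2 : 0 < τ ^ 2 := by positivity
  have hS3 : S ≤ 3 := by nlinarith
  have hδS : δ ≤ S := by linarith
  have hεS : ε ≤ S := by linarith
  have hS0 : 0 < S := by linarith
  have hu : |β - 1| ≤ M * δ := by
    have h3 : K * S * δ ≤ K * 3 * δ := by gcongr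
    have h4 : |β - 1| ≤ |β - 1 - a * δ| + |a * δ| := by
      simpa using abs_add_le (β - 1 - a * δ) (a * δ)
    rw [abs_of_pos (by positivity : 0 < a * δ)] at h4
    rw [hM]
    linarith
  have hu2 : (β - 1) ^ 2 ≤ (M * δ) ^ 2 := sq_le_sq' (by linarith [(abs_le.mp hu).1])
    (abs_le.mp hu).2
  have hlog := abs_log_sub_sub_one_le (b := β) (by linarith)
  obtain ⟨L, hL⟩ : ∃ L, L = Real.log β := ⟨_, rfl⟩
  have hpow : β ^ ε = Real.exp (ε * L) := by
    rw [Real.rpow_def_of_pos hβ, hL, mul_comm]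
  rw [hpow, ← hL]
  rw [← hL] at hlog
  have hL2 : |L| ≤ 2 * M * δ := by
    have h4 : |L| ≤ |L - (β - 1)| + |β - 1| := by
      simpa using abs_add_le (L - (β - 1)) (β - 1)
    nlinarith
  have hLa : |L - a * δ| ≤ (2 * M ^ 2 + K) * S * δ := by
    have h4 : |L - a * δ| ≤ |L - (β - 1)| + |β - 1 - a * δ| := by
      simpa using abs_add_le (L - (β - 1)) (β - 1 - a * δ)
    have h5 : M ^ 2 * δ * δ ≤ M ^ 2 * S * δ := by gcongr
    linarith
  have hLp : |L + a * δ| ≤ (2 * M + a) * δ := by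
    have h4 := abs_add_le L (a * δ)
    rw [abs_of_pos (by positivity : 0 < a * δ)] at h4
    linarith
  have hx : |ε * L| ≤ 1 := by
    rw [abs_mul, abs_of_pos hε]
    exact mul_le_one₀ hε₁.le (abs_nonneg _) (by linarith)
  have hmain := abs_sub_one_mul_exp_add_one_sub_le hx
  have hdiff : |((ε * L - 1) * Real.exp (ε * L) + 1) / ε ^ 2 - L ^ 2 / 2| ≤ ε * |L| ^ 3 := by
    have e : ((ε * L - 1) * Real.exp (ε * L) + 1) / ε ^ 2 - L ^ 2 / 2 =
        ((ε * L - 1) * Real.exp (ε * L) + 1 - (ε * L) ^ 2 / 2) / ε ^ 2 := by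
      field_simp
    rw [e, abs_div, abs_of_pos (by positivity : 0 < ε ^ 2), div_le_iff₀ (by positivity)]
    rw [abs_mul, abs_of_pos hε] at hmain
    calc _ ≤ (ε * |L|) ^ 3 := hmain
      _ = _ := by ring
  have hcube : ε * |L| ^ 3 ≤ 8 * M ^ 3 * S * δ ^ 2 := by
    calc ε * |L| ^ 3 ≤ S * (2 * M * δ) ^ 3 := by gcongr
      _ = 8 * M ^ 3 * S * δ ^ 2 * δ := by ring
      _ ≤ 8 * M ^ 3 * S * δ ^ 2 * 1 := by gcongr
      _ = _ := mul_one _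
  have hsq : |L ^ 2 / 2 - a ^ 2 * δ ^ 2 / 2| ≤ (2 * M ^ 2 + K) * (2 * M + a) * S * δ ^ 2 := by
    have e : L ^ 2 / 2 - a ^ 2 * δ ^ 2 / 2 = (L - a * δ) * (L + a * δ) / 2 := by ring
    rw [e, abs_div, abs_mul, abs_of_pos (by norm_num : (0 : ℝ) < 2)]
    calc |L - a * δ| * |L + a * δ| / 2 ≤ |L - a * δ| * |L + a * δ| := half_le_self (by positivity)
      _ ≤ (2 * M ^ 2 + K) * S * δ * ((2 * M + a) * δ) := by gcongr
      _ = _ := by ring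
  have htri := abs_sub_le (((ε * L - 1) * Real.exp (ε * L) + 1) / ε ^ 2) (L ^ 2 / 2)
    (a ^ 2 * δ ^ 2 / 2)
  linarith
end

section
/- There exist positive constants δ₀, ε₀, τ₀ and C, depending only on a_∞ and K, such that whenever 0 < δ < δ₀, 0 < ε < ε₀, 0 < τ < τ₀, β₁ > 0 satisfies |β₁ − 1 − a_∞δ| ≤ K(δ + ε + τ²)δ, and φ ∈ ℝ satisfies |φ + δ| ≤ K(ε + τ²)δ, the quantity B = 2(β₁^ε − 1)/(a_∞²ε) + (δ + φ)² satisfies |B − 2δ/a_∞| ≤ C(δ + ε + τ²)δ. -/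
/-- For exponents `ε ∈ (0, 1]` and `|x| ≤ 1/2`, the difference quotient `((1 + x)^ε - 1)/ε`
agrees with `x` up to a quadratic error that is uniform in `ε`. -/
lemma abs_one_add_rpow_sub_one_div_sub_le {x ε : ℝ} (hx : |x| ≤ 1 / 2) (hε : 0 < ε)
    (hε1 : ε ≤ 1) : |((1 + x) ^ ε - 1) / ε - x| ≤ 2 * x ^ 2 := by
  obtain ⟨hl, hr⟩ := abs_le.mp hx
  have hpos : 0 < 1 + x := by linarith
  have upper : (1 + x) ^ ε ≤ 1 + ε * x :=
    rpow_one_add_le_one_add_mul_self (by linarith) hε.le hε1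
  have hlog : x - 2 * x ^ 2 ≤ Real.log (1 + x) := by
    refine le_trans ?_ (Real.one_sub_inv_le_log_of_pos hpos)
    have h : 1 - (1 + x)⁻¹ - (x - 2 * x ^ 2) = x ^ 2 * (1 + 2 * x) / (1 + x) := by
      field_simp
      ring
    have : 0 ≤ x ^ 2 * (1 + 2 * x) / (1 + x) :=
      div_nonneg (mul_nonneg (sq_nonneg x) (by linarith)) hpos.le
    linarith
  have lower : 1 + ε * (x - 2 * x ^ 2) ≤ (1 + x) ^ ε := by
    rw [Real.rpow_def_of_pos hpos]
    have h1 := Real.add_one_le_exp (Real.log (1 + x) * ε)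
    have h2 := mul_le_mul_of_nonneg_left hlog hε.le
    linarith
  have h1 : ((1 + x) ^ ε - 1) / ε ≤ x := by
    rw [div_le_iff₀ hε]
    linarith
  have h2 : x - 2 * x ^ 2 ≤ ((1 + x) ^ ε - 1) / ε := by
    rw [le_div_iff₀ hε]
    linarith
  rw [abs_le]
  constructor <;> linarith [sq_nonneg x]

/-- If the shock strength `β₁` satisfies `β₁ = 1 + a_∞δ + O(δ+ε+τ²)δ` and the velocity
jump `φ` satisfies `φ = −δ + O(ε+τ²)δ`, then the Bernoulli-type quantity
`B = 2(β₁^ε − 1)/(a_∞²ε) + (δ + φ)²` satisfies `B = 2δ/a_∞ + O(δ+ε+τ²)δ`, with constants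
depending only on `a_∞` and `K`. -/
theorem bernoulli_quantity_estimate (a K : ℝ) (ha : 0 < a) (hK : 0 < K) :
    ∃ δ₀ ε₀ τ₀ C : ℝ, 0 < δ₀ ∧ 0 < ε₀ ∧ 0 < τ₀ ∧ 0 < C ∧
      ∀ δ ε τ β φ : ℝ, 0 < δ → δ < δ₀ → 0 < ε → ε < ε₀ → 0 < τ → τ < τ₀ → 0 < β →
        |β - 1 - a * δ| ≤ K * (δ + ε + τ ^ 2) * δ →
        |φ + δ| ≤ K * (ε + τ ^ 2) * δ →
        |(2 * (β ^ ε - 1) / (a ^ 2 * ε) + (δ + φ) ^ 2) - 2 * δ / a| ≤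
          C * (δ + ε + τ ^ 2) * δ := by
  set M := a + 3 * K with hM
  have hMpos : 0 < M := by positivity
  refine ⟨min 1 (1 / (2 * M)), 1, 1, 2 / a ^ 2 * (K + 2 * M ^ 2) + 2 * K ^ 2,
    by positivity, one_pos, one_pos, by positivity, ?_⟩
  intro δ ε τ β φ hδ hδ₀ hε hε1 hτ hτ1 _ hβ hφ
  obtain ⟨hδ1, hδM⟩ := lt_min_iff.mp hδ₀
  have hτ2 : τ ^ 2 < 1 := by nlinarith
  have hs : δ ≤ δ + ε + τ ^ 2 := by nlinarith [sq_nonneg τ]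
  have hx : |β - 1| ≤ M * δ := by
    have h1 : |β - 1| ≤ |β - 1 - a * δ| + |a * δ| := by
      simpa using abs_add_le (β - 1 - a * δ) (a * δ)
    rw [abs_of_pos (mul_pos ha hδ)] at h1
    have h2 : K * (δ + ε + τ ^ 2) * δ ≤ K * 3 * δ := by
      gcongr
      linarith
    rw [hM]
    linarith
  have hhalf : |β - 1| ≤ 1 / 2 := by
    rw [lt_div_iff₀ (by positivity)] at hδM
    linarith
  have hxsq : (β - 1) ^ 2 ≤ M ^ 2 * ((δ + ε + τ ^ 2) * δ) := by
    calc (β - 1) ^ 2 = |β - 1| ^ 2 := (sq_abs _).symm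
      _ ≤ (M * δ) ^ 2 := by gcongr
      _ = M ^ 2 * (δ * δ) := by ring
      _ ≤ M ^ 2 * ((δ + ε + τ ^ 2) * δ) := by gcongr
  have hq := abs_one_add_rpow_sub_one_div_sub_le hhalf hε hε1.le
  rw [add_sub_cancel] at hq
  have hy : |(β ^ ε - 1) / ε - a * δ| ≤ (K + 2 * M ^ 2) * ((δ + ε + τ ^ 2) * δ) := by
    have := abs_sub_le ((β ^ ε - 1) / ε) (β - 1) (a * δ)
    linarith
  have hsq : (δ + φ) ^ 2 ≤ 2 * K ^ 2 * ((δ + ε + τ ^ 2) * δ) := by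
    calc (δ + φ) ^ 2 = |φ + δ| ^ 2 := by rw [sq_abs, add_comm]
      _ ≤ (K * (ε + τ ^ 2) * δ) ^ 2 := by gcongr
      _ = K ^ 2 * (ε + τ ^ 2) * ((ε + τ ^ 2) * δ) * δ := by ring
      _ ≤ K ^ 2 * 2 * ((δ + ε + τ ^ 2) * δ) * 1 := by
        gcongr <;> linarith
      _ = 2 * K ^ 2 * ((δ + ε + τ ^ 2) * δ) := by ring
  have hsplit : (2 * (β ^ ε - 1) / (a ^ 2 * ε) + (δ + φ) ^ 2) - 2 * δ / a =
      2 / a ^ 2 * ((β ^ ε - 1) / ε - a * δ) + (δ + φ) ^ 2 := by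
    field_simp
    ring
  rw [hsplit]
  calc |2 / a ^ 2 * ((β ^ ε - 1) / ε - a * δ) + (δ + φ) ^ 2|
      ≤ |2 / a ^ 2 * ((β ^ ε - 1) / ε - a * δ)| + |(δ + φ) ^ 2| := abs_add_le _ _
    _ = 2 / a ^ 2 * |(β ^ ε - 1) / ε - a * δ| + (δ + φ) ^ 2 := by
      rw [abs_mul, abs_of_pos (by positivity : 0 < 2 / a ^ 2), abs_of_nonneg (sq_nonneg (δ + φ))]
    _ ≤ 2 / a ^ 2 * ((K + 2 * M ^ 2) * ((δ + ε + τ ^ 2) * δ)) +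
        2 * K ^ 2 * ((δ + ε + τ ^ 2) * δ) := by gcongr
    _ = (2 / a ^ 2 * (K + 2 * M ^ 2) + 2 * K ^ 2) * (δ + ε + τ ^ 2) * δ := by ring
end

section
/- For every ρ > 0, v ∈ ℝ, ε ≠ 0 and t ≥ 0 with t·B(ρ,v,ε) < 1, writing B = B(ρ,v,ε) and s = √(1 − tB), the partial derivatives of Ψ are: ∂Ψ/∂ρ = ρ^{ε−1}/(a_∞² s), ∂Ψ/∂v = v/s, ∂Ψ/∂ε = (ε·ρ^ε·ln ρ − ρ^ε + 1)/(a_∞² ε² s), and ∂Ψ/∂t = B²/(2 s (s + 1)²). -/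
/-- `Ψ(ρ,v,ε,t) = B/(√(1 − tB) + 1)`, where `t` plays the role of `τ²`; it relates the
horizontal velocity `u` to `(ρ,v)` via `u = −Ψ` in the scaled potential-flow equations. -/
noncomputable def Psi (a ρ v ε t : ℝ) : ℝ :=
  Bfun a ρ v ε / (Real.sqrt (1 - t * Bfun a ρ v ε) + 1)

/-- The derivative of `y ↦ y / (√(1 - t y) + 1)` is `1 / (2 √(1 - t y))`. -/
theorem hasDerivAt_div_sqrt_one_sub_mul_add_one {t b : ℝ} (h : t * b < 1) :
    HasDerivAt (fun y : ℝ => y / (Real.sqrt (1 - t * y) + 1))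
      (1 / (2 * Real.sqrt (1 - t * b))) b := by
  have hpos : 0 < 1 - t * b := by linarith
  have hs : 0 < Real.sqrt (1 - t * b) := Real.sqrt_pos.2 hpos
  have hsq : Real.sqrt (1 - t * b) ^ 2 = 1 - t * b := Real.sq_sqrt hpos.le
  have hsqrt := (((hasDerivAt_id' b).const_mul t).const_sub 1).sqrt hpos.ne'
  refine ((hasDerivAt_id' b).div (hsqrt.add_const 1) (by positivity)).congr_deriv ?_
  field_simp
  linear_combination hsq

/-- The derivative of `y ↦ b / (√(1 - y b) + 1)`, the companion of
`hasDerivAt_div_sqrt_one_sub_mul_add_one` in the other variable. -/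
theorem hasDerivAt_const_div_sqrt_one_sub_mul_add_one {t b : ℝ} (h : t * b < 1) :
    HasDerivAt (fun y : ℝ => b / (Real.sqrt (1 - y * b) + 1))
      (b ^ 2 / (2 * Real.sqrt (1 - t * b) * (Real.sqrt (1 - t * b) + 1) ^ 2)) t := by
  have hpos : 0 < 1 - t * b := by linarith
  have hs : 0 < Real.sqrt (1 - t * b) := Real.sqrt_pos.2 hpos
  have hsqrt := (((hasDerivAt_id' t).mul_const b).const_sub 1).sqrt hpos.ne'
  refine ((hasDerivAt_const t b).div (hsqrt.add_const 1) (by positivity)).congr_deriv ?_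
  field_simp
  ring

/-- For `ρ > 0`, `v ∈ ℝ`, `ε ≠ 0` and `t ≥ 0` with `t·B < 1`, writing `s = √(1 − tB)`:
`∂Ψ/∂ρ = ρ^{ε−1}/(a²s)`, `∂Ψ/∂v = v/s`, `∂Ψ/∂ε = (ε ρ^ε ln ρ − ρ^ε + 1)/(a²ε²s)`, and
`∂Ψ/∂t = B²/(2s(s+1)²)`. -/
theorem Psi_partial_derivs (a ρ v ε t : ℝ) (ha : 0 < a) (hρ : 0 < ρ) (hε : ε ≠ 0)
    (ht : 0 ≤ t) (htB : t * Bfun a ρ v ε < 1) :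
    HasDerivAt (fun x : ℝ => Psi a x v ε t)
      (ρ ^ (ε - 1) / (a ^ 2 * Real.sqrt (1 - t * Bfun a ρ v ε))) ρ ∧
    HasDerivAt (fun x : ℝ => Psi a ρ x ε t)
      (v / Real.sqrt (1 - t * Bfun a ρ v ε)) v ∧
    HasDerivAt (fun x : ℝ => Psi a ρ v x t)
      ((ε * ρ ^ ε * Real.log ρ - ρ ^ ε + 1) /
        (a ^ 2 * ε ^ 2 * Real.sqrt (1 - t * Bfun a ρ v ε))) ε ∧
    HasDerivAt (fun x : ℝ => Psi a ρ v ε x)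
      ((Bfun a ρ v ε) ^ 2 /
        (2 * Real.sqrt (1 - t * Bfun a ρ v ε) *
          (Real.sqrt (1 - t * Bfun a ρ v ε) + 1) ^ 2)) t := by
  have hs : 0 < Real.sqrt (1 - t * Bfun a ρ v ε) := Real.sqrt_pos.2 (by linarith)
  have houter := hasDerivAt_div_sqrt_one_sub_mul_add_one htB
  refine ⟨?_, ?_, ?_, hasDerivAt_const_div_sqrt_one_sub_mul_add_one htB⟩
  · have hB : HasDerivAt (fun x : ℝ => Bfun a x v ε) (2 * ρ ^ (ε - 1) / a ^ 2) ρ := by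
      refine (((((Real.hasDerivAt_rpow_const (Or.inl hρ.ne')).sub_const 1).const_mul
        2).div_const (a ^ 2 * ε)).add_const (v ^ 2)).congr_deriv ?_
      field_simp
    refine (houter.comp ρ hB).congr_deriv ?_
    field_simp
  · have hB : HasDerivAt (fun x : ℝ => Bfun a ρ x ε) (2 * v) v := by
      refine (((hasDerivAt_id' v).pow 2).const_add (2 * (ρ ^ ε - 1) / (a ^ 2 * ε))).congr_deriv ?_
      simp
    refine (houter.comp v hB).congr_deriv ?_
    field_simp
  · have hB : HasDerivAt (fun x : ℝ => Bfun a ρ v x)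
        (2 * (ε * ρ ^ ε * Real.log ρ - ρ ^ ε + 1) / (a ^ 2 * ε ^ 2)) ε := by
      have hrpow : HasDerivAt (fun x : ℝ => ρ ^ x) (ρ ^ ε * Real.log ρ) ε :=
        (Real.hasStrictDerivAt_const_rpow hρ ε).hasDerivAt
      refine ((((hrpow.sub_const 1).const_mul 2).div ((hasDerivAt_id' ε).const_mul (a ^ 2))
        (by positivity)).add_const (v ^ 2)).congr_deriv ?_
      field_simp
      ring
    refine (houter.comp ε hB).congr_deriv ?_
    field_simp
end
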